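/- For every integer k ≥ 1 and every real x ∈ (−0.05, 0): if k is even then xᵏ/(2·k!) < exp(x) − Σ_{i=0}^{k−1} xⁱ/i! < xᵏ/k!, and if k is odd then xᵏ/k! < exp(x) − Σ_{i=0}^{k−1} xⁱ/i! < xᵏ/(2·k!). -/

import Mathlib

theorem exp_lagrange (n : ℕ) (x : ℝ) (hx : x < 0) : ∃ c, x < c ∧ c < 0 ∧
    Real.exp x - ∑ i ∈ Finset.range (n + 1), x ^ i / (Nat.factorial i : ℝ)
      = Real.exp c * x ^ (n + 1) / ((n + 1).factorial : ℝ) := by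
  obtain ⟨c, hc, h⟩ := taylor_mean_remainder_lagrange_iteratedDeriv (f := Real.exp) (x := x)
    (x₀ := 0) (n := n) hx.ne' Real.contDiff_exp.contDiffOn
  rw [Set.uIoo_of_gt hx] at hc
  refine ⟨c, hc.1, hc.2, ?_⟩
  rw [taylor_within_apply] at h
  have hs : ∀ i, iteratedDerivWithin i Real.exp (Set.uIcc 0 x) 0 = 1 := by
    intro i
    rw [iteratedDerivWithin_eq_iteratedDeriv (uniqueDiffOn_uIcc hx.ne')
      Real.contDiff_exp.contDiffAt Set.left_mem_uIcc]
    simp [iteratedDeriv_eq_iterate]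
  simp only [hs, iteratedDeriv_eq_iterate, Real.iter_deriv_exp, sub_zero, smul_eq_mul, mul_one] at h
  rw [← h]
  congr 1
  apply Finset.sum_congr rfl
  intro i _
  rw [div_eq_inv_mul]

theorem exp_taylor_remainder_neg : ∀ k : ℕ, 1 ≤ k → ∀ x : ℝ, -0.05 < x → x < 0 →
    (Even k →
      x^k / (2 * (Nat.factorial k : ℝ)) <
        Real.exp x - ∑ i ∈ Finset.range k, x^i / (Nat.factorial i : ℝ) ∧
      Real.exp x - ∑ i ∈ Finset.range k, x^i / (Nat.factorial i : ℝ) <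
        x^k / (Nat.factorial k : ℝ)) ∧
    (Odd k →
      x^k / (Nat.factorial k : ℝ) <
        Real.exp x - ∑ i ∈ Finset.range k, x^i / (Nat.factorial i : ℝ) ∧
      Real.exp x - ∑ i ∈ Finset.range k, x^i / (Nat.factorial i : ℝ) <
        x^k / (2 * (Nat.factorial k : ℝ))) := by
  intro k hk x hx0 hx
  obtain ⟨n, rfl⟩ : ∃ n, k = n + 1 := ⟨k - 1, by omega⟩
  obtain ⟨c, hc1, hc2, h⟩ := exp_lagrange n x hx
  rw [h]
  have hf : (0 : ℝ) < ((n + 1).factorial : ℝ) := by positivity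
  have hlt : Real.exp c < 1 := by simpa using hc2
  have hgt : 1 / 2 < Real.exp c := by
    have := Real.add_one_le_exp c
    norm_num at hx0
    linarith
  have e2 : x ^ (n + 1) / (2 * ((n + 1).factorial : ℝ))
      = (1 / 2) * (x ^ (n + 1) / ((n + 1).factorial : ℝ)) := by
    field_simp
  rw [e2, mul_div_assoc]
  constructor
  · intro he
    have hp : 0 < x ^ (n + 1) / ((n + 1).factorial : ℝ) := div_pos (he.pow_pos hx.ne) hf
    constructor <;> nlinarith
  · intro ho
    have hp : x ^ (n + 1) / ((n + 1).factorial : ℝ) < 0 := div_neg_of_neg_of_pos (ho.pow_neg hx) hf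
    constructor <;> nlinarith
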